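/- For every x(0) ∈ D(d), the differential equation ẋ(t) = u(x(t)) has a unique solution (x(t))_{t≥0} in D(d) starting from x(0); that is, there exist unique differentiable functions x_k : [0,∞) → [0,1] (1 ≤ k ≤ d) with (x_1(t),…,x_d(t),0,0,…) ∈ D(d), x_k(0) = x_k(0) as given, and d/dt x_k(t) = u_k(x(t)) for all t ≥ 0 and 1 ≤ k ≤ d. -/

import Mathlib

open Filter

noncomputable section

/-- `pcoef n z j` is `p_j(z) = n (z_j - z_{j+1}) z_{j+1}^(n-1)`. -/
def pcoef (n : ℕ) (z : ℕ → ℝ) (j : ℕ) : ℝ :=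
  (n : ℝ) * (z j - z (j + 1)) * z (j + 1) ^ (n - 1)

/-- The `j`-th factor `z_{j+1}^n / (1 - p_j(z))` of `μ(z,·)`,
with the convention that a factor of the form `0/0` equals `1`. -/
def muFactor (n : ℕ) (z : ℕ → ℝ) (j : ℕ) : ℝ :=
  if z (j + 1) ^ n = 0 ∧ 1 - pcoef n z j = 0 then 1
  else z (j + 1) ^ n / (1 - pcoef n z j)

/-- `mu n z k` is `μ(z,k) = ∏_{j=1}^k z_j^n / (1 - p_{j-1}(z))`. -/
def mu (n : ℕ) (z : ℕ → ℝ) (k : ℕ) : ℝ :=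
  ∏ j ∈ Finset.range k, muFactor n z j

/-- The vector field `v_k(z) = λ z_{k-1}^n μ(z,k-1) - λ z_k^n μ(z,k) - (z_k - z_{k+1})`,
meaningful for `k ≥ 1`. -/
def vfield (lam : ℝ) (n : ℕ) (z : ℕ → ℝ) (k : ℕ) : ℝ :=
  lam * z (k - 1) ^ n * mu n z (k - 1) - lam * z k ^ n * mu n z k - (z k - z (k + 1))

/-- Membership in `D`: non-increasing `[0,1]`-valued summable sequences,
with the convention `z 0 = 1`. -/
def memD (z : ℕ → ℝ) : Prop :=
  z 0 = 1 ∧ (∀ k, z (k + 1) ≤ z k) ∧ (∀ k, 0 ≤ z k ∧ z k ≤ 1) ∧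
    Summable (fun k => z (k + 1))

/-- A solution of `ż = v(z)` in `D`: a family of functions `z k : [0,∞) → [0,1]`,
lying in `D` at each time `t ≥ 0`, differentiable with derivative `v_k(z(t))` for `k ≥ 1`. -/
def IsSolution (lam : ℝ) (n : ℕ) (z : ℕ → ℝ → ℝ) : Prop :=
  (∀ t : ℝ, 0 ≤ t → memD (fun k => z k t)) ∧
  (∀ k : ℕ, 1 ≤ k → ∀ t : ℝ, 0 ≤ t →
    HasDerivWithinAt (z k) (vfield lam n (fun j => z j t) k) (Set.Ici 0) t)

/-- Membership in `D(d)`: `0 ≤ x_d ≤ ⋯ ≤ x_1 ≤ 1` and `x_k = 0` for `k > d`,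
with the convention `x 0 = 1`. -/
def memDd (d : ℕ) (x : ℕ → ℝ) : Prop :=
  x 0 = 1 ∧ (∀ k, x (k + 1) ≤ x k) ∧ (∀ k, 0 ≤ x k ∧ x k ≤ 1) ∧
    (∀ k, d < k → x k = 0)

/-- The truncated vector field `u = u^(d)`. -/
def ufield (lam : ℝ) (n : ℕ) (d : ℕ) (x : ℕ → ℝ) (k : ℕ) : ℝ :=
  if k < d then vfield lam n x k
  else if k = d then
    lam * x (d - 1) ^ n * mu n x (d - 1) - lam * x d ^ n * mu n x d - x d
  else 0

/-- A solution of the truncated system `ẋ = u^(d)(x)` in `D(d)`. -/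
def IsSolutionTrunc (lam : ℝ) (n : ℕ) (d : ℕ) (x : ℕ → ℝ → ℝ) : Prop :=
  (∀ t : ℝ, 0 ≤ t → memDd d (fun k => x k t)) ∧
  (∀ k : ℕ, 1 ≤ k → ∀ t : ℝ, 0 ≤ t →
    HasDerivWithinAt (x k) (ufield lam n d (fun j => x j t) k) (Set.Ici 0) t)

open Set in
/-- Global forward existence for a bounded, globally Lipschitz field. -/
lemma global_ode {E : Type*} [NormedAddCommGroup E] [NormedSpace ℝ E] [CompleteSpace E]
    (F : E → E) (K C : NNReal) (hK : LipschitzWith K F) (hC : ∀ x, ‖F x‖ ≤ C) (x0 : E) :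
    ∃ α : ℝ → E, α 0 = x0 ∧ ∀ t, 0 ≤ t → HasDerivWithinAt α (F (α t)) (Ici 0) t := by
  have step : ∀ N : ℕ, ∃ α : ℝ → E, α 0 = x0 ∧
      ∀ t ∈ Icc (0:ℝ) N, HasDerivWithinAt α (F (α t)) (Icc (0:ℝ) N) t := by
    intro N
    have h0 : (0:ℝ) ∈ Icc (0:ℝ) N := ⟨le_rfl, Nat.cast_nonneg N⟩
    have h : IsPicardLindelof (fun _ => F) (⟨0, h0⟩ : Icc (0:ℝ) N) x0 (C * N) 0 C K := by
      apply IsPicardLindelof.of_time_independent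
      · intro x _; exact hC x
      · exact hK.lipschitzOnWith
      · simp
    exact h.exists_eq_forall_mem_Icc_hasDerivWithinAt₀
  choose α hα0 hα using step
  have agree : ∀ M N : ℕ, M ≤ N → EqOn (α M) (α N) (Icc 0 (M:ℝ)) := by
    intro M N hMN
    have hMN' : (M:ℝ) ≤ N := by exact_mod_cast hMN
    have hr : ∀ P : ℕ, M ≤ P → ∀ t ∈ Ico (0:ℝ) M,
        HasDerivWithinAt (α P) (F (α P t)) (Ici t) t := by
      intro P hP t ht
      have hP' : (M:ℝ) ≤ P := by exact_mod_cast hP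
      have h1 := hα P t ⟨ht.1, ht.2.le.trans hP'⟩
      refine h1.mono_of_mem_nhdsWithin ?_
      exact mem_of_superset (Icc_mem_nhdsGE (ht.2.trans_le hP')) (Icc_subset_Icc_left ht.1)
    have hc : ∀ P : ℕ, M ≤ P → ContinuousOn (α P) (Icc (0:ℝ) M) := by
      intro P hP
      have hP' : (M:ℝ) ≤ P := by exact_mod_cast hP
      have : ContinuousOn (α P) (Icc (0:ℝ) P) := fun t ht => (hα P t ht).continuousWithinAt
      exact this.mono (Icc_subset_Icc_right hP')
    exact ODE_solution_unique_of_mem_Icc_right (v := fun _ => F) (s := fun _ => univ) (K := K)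
      (fun _ _ => hK.lipschitzOnWith) (hc M le_rfl) (hr M le_rfl) (fun _ _ => trivial)
      (hc N hMN) (hr N hMN) (fun _ _ => trivial) (by rw [hα0, hα0])
  have key : ∀ N : ℕ, ∀ t ∈ Icc (0:ℝ) N, α (⌈t⌉₊) t = α N t := by
    intro N t ht
    apply agree _ _ (Nat.ceil_le.2 ht.2) ⟨ht.1, Nat.le_ceil t⟩
  refine ⟨fun t => α (⌈t⌉₊) t, by simp [hα0], ?_⟩
  intro t ht
  set N := ⌈t⌉₊ + 1 with hN
  have htN : t < N := by
    have := Nat.le_ceil t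
    push_cast [hN]; linarith
  have h1 := hα N t ⟨ht, htN.le⟩
  simp only [key N t ⟨ht, htN.le⟩]
  have h2 : HasDerivWithinAt (fun t => α (⌈t⌉₊) t) (F (α N t)) (Icc (0:ℝ) N) t :=
    h1.congr (fun s hs => key N s hs) (key N t ⟨ht, htN.le⟩)
  refine h2.mono_of_mem_nhdsWithin ?_
  have : Iio (N:ℝ) ∈ nhdsWithin t (Ici 0) := mem_nhdsWithin_of_mem_nhds (Iio_mem_nhds htN)
  filter_upwards [this, self_mem_nhdsWithin] with s hs hs'
  exact ⟨hs', le_of_lt hs⟩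

open Set in
/-- A function that does not increase while it is positive stays nonpositive. -/
lemma stays_nonpos (h h' : ℝ → ℝ) (h0 : h 0 ≤ 0)
    (hd : ∀ t, 0 ≤ t → HasDerivWithinAt h (h' t) (Ici 0) t)
    (hb : ∀ t, 0 ≤ t → 0 ≤ h t → h' t ≤ 0) : ∀ t, 0 ≤ t → h t ≤ 0 := by
  intro t ht
  have hc : ContinuousOn h (Icc 0 t) := fun s hs =>
    ((hd s hs.1).continuousWithinAt).mono Icc_subset_Ici_self
  have key : ∀ ε > 0, h t ≤ ε * (1 + t) := by
    intro ε hε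
    refine image_le_of_deriv_right_lt_deriv_boundary (f := h) (f' := h') (a := 0) (b := t)
      (B := fun s => ε * (1 + s)) (B' := fun _ => ε) hc ?_ ?_ ?_ ?_ ⟨ht, le_rfl⟩
    · intro s hs
      exact (hd s hs.1).mono (Ici_subset_Ici.2 hs.1)
    · simp; linarith
    · intro s
      simpa using ((hasDerivAt_id s).const_add 1).const_mul ε
    · intro s hs he
      have : 0 ≤ h s := by rw [he]; have := hs.1; positivity
      exact (hb s hs.1 this).trans_lt hε
  by_contra hcon
  push Not at hcon
  have := key (h t / (2 * (1 + t))) (by positivity)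
  have h2 : h t / (2 * (1 + t)) * (1 + t) = h t / 2 := by field_simp
  linarith

/-- Bernoulli: `p ≤ a^n - b^n`. -/
lemma bern (n : ℕ) (a b : ℝ) (hb : 0 ≤ b) (hab : b ≤ a) :
    (n : ℝ) * (a - b) * b ^ (n - 1) ≤ a ^ n - b ^ n := by
  induction n with
  | zero => simp
  | succ n ih =>
    have h1 : (n:ℝ) * (a - b) * b ^ n ≤ b * (a ^ n - b ^ n) := by
      rcases n with _ | m
      · simp
      · have := mul_le_mul_of_nonneg_left ih hb
        simp only [Nat.add_sub_cancel] at this ⊢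
        calc _ = b * (((m + 1 : ℕ):ℝ) * (a - b) * b ^ m) := by ring
          _ ≤ _ := this
    have h2 : b ^ n ≤ a ^ n := pow_le_pow_left₀ hb hab n
    push_cast
    try simp only [Nat.add_sub_cancel]
    have h3 : (a - b) * b ^ n ≤ (a - b) * a ^ n :=
      mul_le_mul_of_nonneg_left h2 (by linarith)
    have e1 : a ^ (n+1) = a * a ^ n := by ring
    have e2 : b ^ (n+1) = b * b ^ n := by ring
    rw [e1, e2]
    nlinarith

lemma pow_lip (n : ℕ) (a b : ℝ) (ha : 0 ≤ a) (ha1 : a ≤ 1) (hb : 0 ≤ b) (hb1 : b ≤ 1) :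
    |a ^ n - b ^ n| ≤ n * |a - b| := by
  refine (abs_pow_sub_pow_le a b n).trans ?_
  have h : max |a| |b| ^ (n - 1) ≤ 1 := by
    apply pow_le_one₀ (by positivity)
    rw [abs_of_nonneg ha, abs_of_nonneg hb]
    exact max_le ha1 hb1
  calc |a - b| * n * max |a| |b| ^ (n - 1) ≤ |a - b| * n * 1 := by gcongr
    _ = _ := by ring

section field
variable {d n : ℕ} {z w : ℕ → ℝ}

lemma pcoef_le (hz : memDd d z) (n j : ℕ) :
    pcoef n z j ≤ z j ^ n - z (j+1) ^ n :=
  bern n _ _ (hz.2.2.1 _).1 (hz.2.1 _)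

lemma powz_mem (hz : memDd d z) (n j : ℕ) : 0 ≤ z j ^ n ∧ z j ^ n ≤ 1 :=
  ⟨pow_nonneg (hz.2.2.1 _).1 _, pow_le_one₀ (hz.2.2.1 _).1 (hz.2.2.1 _).2⟩

lemma pow_anti (hz : memDd d z) (n j : ℕ) : z (j+1) ^ n ≤ z j ^ n :=
  pow_le_pow_left₀ (hz.2.2.1 _).1 (hz.2.1 _) _

lemma le_one_sub (hz : memDd d z) (n j : ℕ) : z (j+1) ^ n ≤ 1 - pcoef n z j := by
  have := pcoef_le hz n j
  have := powz_mem hz n j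
  linarith

lemma muFactor_nonneg (hz : memDd d z) (n j : ℕ) : 0 ≤ muFactor n z j := by
  unfold muFactor
  split_ifs
  · norm_num
  · have h1 := le_one_sub hz n j
    have h2 := (powz_mem hz n (j+1)).1
    exact div_nonneg h2 (h2.trans h1)

lemma muFactor_le_pow (hz : memDd d z) (n j : ℕ) : muFactor n z j ≤ z j ^ n := by
  have h1 := pcoef_le hz n j
  have h2 := powz_mem hz n j
  have h3 := powz_mem hz n (j+1)
  have h4 := pow_anti hz n j
  unfold muFactor
  split_ifs with h
  · linarith [h.1, h.2]
  · have hpos : 0 < 1 - pcoef n z j := by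
      rcases lt_or_eq_of_le (h3.1.trans (le_one_sub hz n j)) with h5 | h5
      · exact h5
      · exact absurd ⟨le_antisymm (by rw [h5]; exact le_one_sub hz n j) h3.1, h5.symm⟩ h
    rw [div_le_iff₀ hpos]
    have h5 : z j ^ n * (1 - z j ^ n + z (j+1) ^ n) ≤ z j ^ n * (1 - pcoef n z j) :=
      mul_le_mul_of_nonneg_left (by linarith) h2.1
    nlinarith

lemma muFactor_le_one (hz : memDd d z) (n j : ℕ) : muFactor n z j ≤ 1 :=
  (muFactor_le_pow hz n j).trans (powz_mem hz n j).2

lemma mu_succ (n : ℕ) (z : ℕ → ℝ) (k : ℕ) : mu n z (k+1) = mu n z k * muFactor n z k := by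
  simp [mu, Finset.prod_range_succ]

lemma mu_mem (hz : memDd d z) (n k : ℕ) : 0 ≤ mu n z k ∧ mu n z k ≤ 1 := by
  constructor
  · exact Finset.prod_nonneg fun j _ => muFactor_nonneg hz n j
  · exact Finset.prod_le_one (fun j _ => muFactor_nonneg hz n j)
      fun j _ => muFactor_le_one hz n j

lemma pcoef_lip (hz : memDd d z) (hw : memDd d w) (n : ℕ) (δ : ℝ)
    (hδ : ∀ k, |z k - w k| ≤ δ) (j : ℕ) :
    |pcoef n z j - pcoef n w j| ≤ n * (n + 2) * δ := by
  have hz1 := hz.2.2.1 (j+1)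
  have hw1 := hw.2.2.1 (j+1)
  have hzd := hz.2.1 j
  have hz0 := hz.2.2.1 j
  have hδ0 : 0 ≤ δ := (abs_nonneg _).trans (hδ 0)
  have e1 : |z (j+1) ^ (n-1) - w (j+1) ^ (n-1)| ≤ n * δ := by
    refine (pow_lip (n-1) _ _ hz1.1 hz1.2 hw1.1 hw1.2).trans ?_
    have : ((n - 1 : ℕ):ℝ) ≤ n := by exact_mod_cast Nat.sub_le n 1
    exact mul_le_mul this (hδ _) (abs_nonneg _) (Nat.cast_nonneg _)
  have e2 : |(z j - z (j+1)) - (w j - w (j+1))| ≤ 2 * δ := by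
    have h1 := hδ j
    have h2 := hδ (j+1)
    rw [abs_le] at *
    constructor <;> linarith
  have hp := powz_mem hw (n-1) (j+1)
  have e3 : |(z j - z (j+1))| ≤ 1 := by
    rw [abs_le]; constructor <;> linarith
  have e4 : |w (j+1) ^ (n-1)| ≤ 1 := by
    rw [abs_of_nonneg hp.1]; exact hp.2
  have : pcoef n z j - pcoef n w j =
      n * ((z j - z (j+1)) * (z (j+1) ^ (n-1) - w (j+1) ^ (n-1))
        + ((z j - z (j+1)) - (w j - w (j+1))) * w (j+1) ^ (n-1)) := by
    unfold pcoef; ring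
  rw [this, abs_mul, Nat.abs_cast, mul_assoc]
  apply mul_le_mul_of_nonneg_left _ (Nat.cast_nonneg n)
  refine (abs_add_le _ _).trans ?_
  rw [abs_mul, abs_mul]
  have f1 : |(z j - z (j+1))| * |z (j+1) ^ (n-1) - w (j+1) ^ (n-1)| ≤ 1 * (n * δ) :=
    mul_le_mul e3 e1 (abs_nonneg _) zero_le_one
  have f2 : |(z j - z (j+1)) - (w j - w (j+1))| * |w (j+1) ^ (n-1)| ≤ 2 * δ * 1 :=
    mul_le_mul e2 e4 (abs_nonneg _) (by positivity)
  linarith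

/-- Lipschitz estimate of quotients, weighted by the numerator. -/
lemma quot_lip (N Q N' Q' A B : ℝ) (hN : 0 ≤ N) (hN' : 0 ≤ N') (hQ : N ≤ Q) (hQ' : N' ≤ Q')
    (hA : |N - N'| ≤ A) (hB : |Q - Q'| ≤ B) (f f' : ℝ)
    (hf : f = if N = 0 ∧ Q = 0 then 1 else N / Q)
    (hf' : f' = if N' = 0 ∧ Q' = 0 then 1 else N' / Q') :
    N' * |f - f'| ≤ A + B := by
  have hA0 := (abs_nonneg _).trans hA
  have hB0 := (abs_nonneg _).trans hB
  rcases eq_or_lt_of_le (hN'.trans hQ') with h | hQp'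
  · have : N' = 0 := by linarith
    rw [this]; simp; linarith
  rw [if_neg (fun h => hQp'.ne' h.2)] at hf'
  have q1 : N' / Q' ≤ 1 := (div_le_one hQp').2 hQ'
  have q0 : 0 ≤ N' / Q' := by positivity
  rcases eq_or_lt_of_le (hN.trans hQ) with h | hQp
  · have hN0 : N = 0 := by linarith
    rw [if_pos ⟨hN0, h.symm⟩] at hf
    have h1 : |f - f'| ≤ 1 := by
      rw [hf, hf', abs_le]; constructor <;> linarith
    have h2 : N' ≤ A := by
      rw [hN0, zero_sub, abs_neg, abs_of_nonneg hN'] at hA; exact hA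
    nlinarith
  rw [if_neg (fun h => hQp.ne' h.2)] at hf
  have r1 : N / Q ≤ 1 := (div_le_one hQp).2 hQ
  have r0 : 0 ≤ N / Q := by positivity
  have e : f - f' = ((N / Q) * (Q' - Q) + (N - N')) / Q' := by
    rw [hf, hf']; field_simp; ring
  rw [e, abs_div, abs_of_pos hQp']
  have h3 : |(N / Q) * (Q' - Q) + (N - N')| ≤ A + B := by
    refine (abs_add_le _ _).trans ?_
    rw [abs_mul, abs_of_nonneg r0, abs_sub_comm Q' Q]
    nlinarith [abs_nonneg (Q - Q')]
  calc N' * (|(N / Q) * (Q' - Q) + (N - N')| / Q')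
      = (N' / Q') * |(N / Q) * (Q' - Q) + (N - N')| := by ring
    _ ≤ 1 * (A + B) := mul_le_mul q1 h3 (abs_nonneg _) zero_le_one
    _ = A + B := one_mul _

lemma muFactor_lip (hz : memDd d z) (hw : memDd d w) (n : ℕ) (δ : ℝ)
    (hδ : ∀ k, |z k - w k| ≤ δ) (j : ℕ) :
    w (j+1) ^ n * |muFactor n z j - muFactor n w j| ≤ n * (n + 3) * δ := by
  have h1 := pcoef_lip hz hw n δ hδ j
  have h2 : |z (j+1) ^ n - w (j+1) ^ n| ≤ n * δ :=
    (pow_lip n _ _ (hz.2.2.1 _).1 (hz.2.2.1 _).2 (hw.2.2.1 _).1 (hw.2.2.1 _).2).trans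
      (mul_le_mul_of_nonneg_left (hδ _) (Nat.cast_nonneg _))
  have h3 : |(1 - pcoef n z j) - (1 - pcoef n w j)| ≤ n * (n + 2) * δ := by
    rw [abs_sub_comm] at h1
    convert h1 using 2; ring
  have := quot_lip _ _ _ _ _ _ (powz_mem hz n (j+1)).1 (powz_mem hw n (j+1)).1
    (le_one_sub hz n j) (le_one_sub hw n j) h2 h3 _ _ rfl rfl
  calc _ ≤ _ := this
    _ = _ := by ring

lemma mu_lip (hz : memDd d z) (hw : memDd d w) (n : ℕ) (δ : ℝ)
    (hδ : ∀ k, |z k - w k| ≤ δ) (m : ℕ) :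
    w m ^ n * |mu n z m - mu n w m| ≤ m * (n * (n + 3) * δ) := by
  induction m with
  | zero => simp [mu]
  | succ m ih =>
    have e : mu n z (m+1) - mu n w (m+1) = (mu n z m - mu n w m) * muFactor n z m
        + mu n w m * (muFactor n z m - muFactor n w m) := by
      rw [mu_succ, mu_succ]; ring
    have h1 := muFactor_lip hz hw n δ hδ m
    have hw1 := powz_mem hw n (m+1)
    have hm := mu_mem hw n m
    have hF0 := muFactor_nonneg hz n m
    have hF1 := muFactor_le_one hz n m
    have t1 : |(mu n z m - mu n w m) * muFactor n z m| ≤ |mu n z m - mu n w m| := by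
      rw [abs_mul, abs_of_nonneg hF0]
      exact mul_le_of_le_one_right (abs_nonneg _) hF1
    have t2 : |mu n w m * (muFactor n z m - muFactor n w m)|
        ≤ |muFactor n z m - muFactor n w m| := by
      rw [abs_mul, abs_of_nonneg hm.1]
      exact mul_le_of_le_one_left (abs_nonneg _) hm.2
    have t3 : |mu n z (m+1) - mu n w (m+1)| ≤ |mu n z m - mu n w m|
        + |muFactor n z m - muFactor n w m| := by
      rw [e]; exact (abs_add_le _ _).trans (add_le_add t1 t2)
    have t4 := mul_le_mul_of_nonneg_left t3 hw1.1
    have t5 := mul_le_mul_of_nonneg_right (pow_anti hw n m) (abs_nonneg (mu n z m - mu n w m))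
    push_cast
    linarith

/-- `g_k = z_k^n μ(z,k)`. -/
def gfun (n : ℕ) (z : ℕ → ℝ) (k : ℕ) : ℝ := z k ^ n * mu n z k

lemma gfun_mem (hz : memDd d z) (n k : ℕ) : 0 ≤ gfun n z k ∧ gfun n z k ≤ 1 := by
  have h1 := powz_mem hz n k
  have h2 := mu_mem hz n k
  exact ⟨mul_nonneg h1.1 h2.1, mul_le_one₀ h1.2 h2.1 h2.2⟩

lemma gfun_lip (hz : memDd d z) (hw : memDd d w) (n : ℕ) (δ : ℝ)
    (hδ : ∀ k, |z k - w k| ≤ δ) (k : ℕ) :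
    |gfun n z k - gfun n w k| ≤ n * δ + k * (n * (n + 3) * δ) := by
  have e : gfun n z k - gfun n w k = (z k ^ n - w k ^ n) * mu n z k
      + w k ^ n * (mu n z k - mu n w k) := by unfold gfun; ring
  have h2 : |z k ^ n - w k ^ n| ≤ n * δ :=
    (pow_lip n _ _ (hz.2.2.1 _).1 (hz.2.2.1 _).2 (hw.2.2.1 _).1 (hw.2.2.1 _).2).trans
      (mul_le_mul_of_nonneg_left (hδ _) (Nat.cast_nonneg _))
  have hm := mu_mem hz n k
  rw [e]
  refine (abs_add_le _ _).trans (add_le_add ?_ ?_)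
  · rw [abs_mul, abs_of_nonneg hm.1]
    exact (mul_le_of_le_one_right (abs_nonneg _) hm.2).trans h2
  · rw [abs_mul, abs_of_nonneg (powz_mem hw n k).1]
    exact mu_lip hz hw n δ hδ k

lemma ufield_eq (lam : ℝ) (n : ℕ) (hz : memDd d z) (k : ℕ) (hk : k + 1 ≤ d) :
    ufield lam n d z (k+1) = lam * gfun n z k - lam * gfun n z (k+1) - (z (k+1) - z (k+2)) := by
  unfold ufield gfun
  split_ifs with h1 h2
  · unfold vfield; simp only [Nat.add_sub_cancel]; ring
  · subst h2
    have := hz.2.2.2 (k+2) (by omega)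
    rw [this]; simp only [Nat.add_sub_cancel]; ring
  · omega

lemma ufield_bound (lam : ℝ) (h0 : 0 < lam) (h1 : lam < 1) (n : ℕ) (hz : memDd d z) (k : ℕ)
    (hk : k + 1 ≤ d) : |ufield lam n d z (k+1)| ≤ 2 := by
  rw [ufield_eq lam n hz k hk]
  have a := gfun_mem hz n k
  have b := gfun_mem hz n (k+1)
  have c := hz.2.2.1 (k+1)
  have e := hz.2.2.1 (k+2)
  rw [abs_le]; constructor <;> nlinarith

lemma ufield_lip (lam : ℝ) (h0 : 0 < lam) (h1 : lam < 1) (n : ℕ)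
    (hz : memDd d z) (hw : memDd d w) (δ : ℝ)
    (hδ : ∀ k, |z k - w k| ≤ δ) (k : ℕ) (hk : k + 1 ≤ d) :
    |ufield lam n d z (k+1) - ufield lam n d w (k+1)|
      ≤ (2 * (n + d * (n * (n + 3))) + 2) * δ := by
  rw [ufield_eq lam n hz k hk, ufield_eq lam n hw k hk]
  have hδ0 : 0 ≤ δ := (abs_nonneg _).trans (hδ 0)
  have G : ∀ m, m ≤ d → |lam * gfun n z m - lam * gfun n w m| ≤ (n + d * (n * (n+3))) * δ := by
    intro m hm
    rw [← mul_sub, abs_mul, abs_of_pos h0]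
    refine (mul_le_of_le_one_left (abs_nonneg _) h1.le).trans ?_
    refine (gfun_lip hz hw n δ hδ m).trans ?_
    have hm' : (m:ℝ) ≤ d := by exact_mod_cast hm
    have : (m:ℝ) * (n * (n + 3) * δ) ≤ d * (n * (n + 3) * δ) :=
      mul_le_mul_of_nonneg_right hm' (by positivity)
    linarith
  have a := G k (by omega)
  have b := G (k+1) hk
  have c := hδ (k+1)
  have e := hδ (k+2)
  rw [abs_le] at *
  constructor <;> linarith

/-- Tangency on the face `z_{k+2} = z_{k+1}`. -/
lemma ufield_tangent (lam : ℝ) (h0 : 0 < lam) (n : ℕ) (hz : memDd d z) (k : ℕ)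
    (hk : k + 2 ≤ d) (he : z (k+2) = z (k+1)) :
    ufield lam n d z (k+2) ≤ ufield lam n d z (k+1) := by
  rw [ufield_eq lam n hz k (by omega), ufield_eq lam n hz (k+1) (by omega)]
  have hd3 := hz.2.1 (k+2)
  have hp : pcoef n z (k+1) = 0 := by
    unfold pcoef; rw [show k + 1 + 1 = k + 2 from rfl, he]; simp
  have hF : muFactor n z (k+1) = z (k+1) ^ n := by
    unfold muFactor; rw [hp, show k + 1 + 1 = k + 2 from rfl, he]; simp
  have g2 : gfun n z (k+2) = z (k+1) ^ n * (mu n z (k+1) * z (k+1) ^ n) := by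
    unfold gfun; rw [mu_succ, hF, he]
  have g1 : gfun n z (k+1) = z (k+1) ^ n * mu n z (k+1) := rfl
  have g0 : mu n z (k+1) ≤ gfun n z k := by
    rw [mu_succ]; unfold gfun
    rw [mul_comm]
    exact mul_le_mul_of_nonneg_right (muFactor_le_pow hz n k) (mu_mem hz n k).1
  have hm := (mu_mem hz n (k+1)).1
  have key : 2 * gfun n z (k+1) - gfun n z (k+2) - gfun n z k ≤ 0 := by
    have : 0 ≤ mu n z (k+1) * (1 - z (k+1) ^ n) ^ 2 := by positivity
    rw [g2, g1]
    nlinarith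
  have := mul_nonpos_of_nonneg_of_nonpos h0.le key
  simp only [show k + 1 + 1 = k + 2 from rfl, show k + 1 + 2 = k + 3 from rfl,
    show k + 2 + 1 = k + 3 from rfl] at *
  rw [he]
  rw [he] at hd3
  linarith

/-- Tangency on the face `z_1 = 1`. -/
lemma ufield_one (lam : ℝ) (n : ℕ) (hz : memDd d z) (hd : 1 ≤ d)
    (he : z 1 = 1) : ufield lam n d z 1 ≤ 0 := by
  rw [show (1:ℕ) = 0 + 1 from rfl, ufield_eq lam n hz 0 (by omega)]
  have h2 := (hz.2.2.1 2).2
  have h0 := hz.1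
  simp [gfun, mu, muFactor, pcoef, he, h0]
  exact h2

/-- Tangency on the face `z_d = 0`. -/
lemma ufield_zero (lam : ℝ) (h0 : 0 < lam) (n : ℕ) (hn : 1 ≤ n) (hz : memDd d z) (hd : 1 ≤ d)
    (he : z d = 0) : 0 ≤ ufield lam n d z d := by
  obtain ⟨e, rfl⟩ : ∃ e, d = e + 1 := ⟨d - 1, by omega⟩
  rw [ufield_eq lam n hz e le_rfl]
  have h2 := hz.2.2.2 (e+2) (by omega)
  have h3 := (gfun_mem hz n e).1
  have h4 : gfun n z (e+1) = 0 := by unfold gfun; rw [he, zero_pow (by omega)]; simp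
  rw [h2, he, h4]
  have := mul_nonneg h0.le h3
  linarith

end field

/-- Retraction of `Fin d → ℝ` on `D(d)`. -/
def retr (d : ℕ) (x : Fin d → ℝ) : ℕ → ℝ
  | 0 => 1
  | k + 1 => if h : k < d then min (retr d x k) (max 0 (x ⟨k, h⟩)) else 0

lemma retr_mem (d : ℕ) (x : Fin d → ℝ) : memDd d (retr d x) := by
  have hb : ∀ k, 0 ≤ retr d x k ∧ retr d x k ≤ 1 := by
    intro k
    induction k with
    | zero => simp [retr]
    | succ k ih =>
      rw [retr]
      split_ifs
      · exact ⟨le_min ih.1 (le_max_left _ _), (min_le_left _ _).trans ih.2⟩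
      · simp
  refine ⟨rfl, ?_, hb, ?_⟩
  · intro k
    rw [retr]
    split_ifs
    · exact min_le_left _ _
    · exact (hb k).1
  · intro k hk
    obtain ⟨e, rfl⟩ : ∃ e, k = e + 1 := ⟨k - 1, by omega⟩
    rw [retr, dif_neg (by omega)]

lemma retr_lip (d : ℕ) (x y : Fin d → ℝ) (k : ℕ) : |retr d x k - retr d y k| ≤ dist x y := by
  induction k with
  | zero => simp [retr]
  | succ k ih =>
    rw [retr, retr]
    split_ifs with h
    · refine (abs_min_sub_min_le_max _ _ _ _).trans (max_le ih ?_)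
      refine (abs_max_sub_max_le_max _ _ _ _).trans (max_le (by simp) ?_)
      rw [← Real.dist_eq]
      exact dist_le_pi_dist x y _
    · simp

lemma retr_eq (d : ℕ) (z : ℕ → ℝ) (hz : memDd d z) :
    retr d (fun i => z (i+1)) = z := by
  funext k
  induction k with
  | zero => exact hz.1.symm
  | succ k ih =>
    rw [retr, ih]
    split_ifs with h
    · simp only
      rw [max_eq_right (hz.2.2.1 _).1, min_eq_right (hz.2.1 _)]
    · exact (hz.2.2.2 _ (by omega)).symm

/-- `x` extended by `x_0 = 1` and `0` beyond `d`. -/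
def extd (d : ℕ) (x : Fin d → ℝ) : ℕ → ℝ
  | 0 => 1
  | k + 1 => if h : k < d then x ⟨k, h⟩ else 0

lemma retr_face (d : ℕ) (x : Fin d → ℝ) (k : ℕ) (hk : k < d)
    (h : extd d x k ≤ extd d x (k+1)) : retr d x (k+1) = retr d x k := by
  have hm := (retr_mem d x).2.2.1 k
  rw [retr, dif_pos hk]
  apply min_eq_left
  rw [extd, dif_pos hk] at h
  rcases k with _ | k
  · rw [retr]; exact le_max_of_le_right h
  · have hk' : k < d := by omega
    rw [extd, dif_pos hk'] at h
    rw [retr, dif_pos hk']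
    exact (min_le_right _ _).trans (max_le_max le_rfl h)

/-- The extended field on `Fin d → ℝ`. -/
def Ffield (lam : ℝ) (n d : ℕ) (x : Fin d → ℝ) : Fin d → ℝ :=
  fun i => ufield lam n d (retr d x) (i + 1)

lemma Ffield_lip (lam : ℝ) (h0 : 0 < lam) (h1 : lam < 1) (n d : ℕ) :
    LipschitzWith (2 * (n + d * (n * (n + 3))) + 2) (Ffield lam n d) := by
  apply LipschitzWith.of_dist_le_mul
  intro x y
  rw [dist_pi_le_iff (by positivity)]
  intro i
  rw [Real.dist_eq]
  have := ufield_lip lam h0 h1 n (retr_mem d x) (retr_mem d y) (dist x y) (retr_lip d x y) i i.2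
  push_cast
  exact this

lemma Ffield_bound (lam : ℝ) (h0 : 0 < lam) (h1 : lam < 1) (n d : ℕ) (x : Fin d → ℝ) :
    ‖Ffield lam n d x‖ ≤ (2 : NNReal) := by
  rw [pi_norm_le_iff_of_nonneg (by positivity)]
  intro i
  exact ufield_bound lam h0 h1 n (retr_mem d x) i i.2

/-- existence and uniqueness for the truncated system ẋ = u^(d)(x) in D(d). -/
theorem stmt3 (lam : ℝ) (hlam0 : 0 < lam) (hlam1 : lam < 1) (n : ℕ) (hn : 1 ≤ n) (d : ℕ) (hd : 1 ≤ d)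
    (x0 : ℕ → ℝ) (hx0 : memDd d x0) :
    ∃ x : ℕ → ℝ → ℝ, (IsSolutionTrunc lam n d x ∧ ∀ k, x k 0 = x0 k) ∧
      ∀ y : ℕ → ℝ → ℝ, IsSolutionTrunc lam n d y → (∀ k, y k 0 = x0 k) →
        ∀ k, 1 ≤ k → k ≤ d → ∀ t : ℝ, 0 ≤ t → y k t = x k t := by
  obtain ⟨α, hα0, hα⟩ := global_ode (Ffield lam n d) _ 2 (Ffield_lip lam hlam0 hlam1 n d)
    (Ffield_bound lam hlam0 hlam1 n d) (fun i => x0 (i+1))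
  have hαi : ∀ i : Fin d, ∀ t, 0 ≤ t → HasDerivWithinAt (fun s => α s i)
      (ufield lam n d (retr d (α t)) (i+1)) (Set.Ici 0) t := by
    intro i t ht
    exact (hasDerivWithinAt_pi.1 (hα t ht)) i
  have hstart : ∀ k, extd d (α 0) k = x0 k := by
    intro k
    rcases k with _ | k
    · exact hx0.1.symm
    · rw [extd]
      split_ifs with h
      · rw [hα0]
      · exact (hx0.2.2.2 _ (by omega)).symm
  have hmono : ∀ k t, 0 ≤ t → extd d (α t) (k+1) ≤ extd d (α t) k := by
    intro k
    have hi : extd d (α 0) (k+1) - extd d (α 0) k ≤ 0 := by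
      rw [hstart, hstart]; linarith [hx0.2.1 k]
    suffices H : ∀ t, 0 ≤ t → extd d (α t) (k+1) - extd d (α t) k ≤ 0 from
      fun t ht => by linarith [H t ht]
    rcases lt_trichotomy k d with hk | hk | hk
    · rcases k with _ | k
      · refine stays_nonpos (fun t => extd d (α t) (0+1) - extd d (α t) 0)
          (fun t => ufield lam n d (retr d (α t)) 1) hi ?_ ?_
        · intro t ht
          simp only [extd, dif_pos hk]
          exact (hαi ⟨0, hk⟩ t ht).sub_const 1
        · intro t ht h
          have := retr_face d (α t) 0 hk (by linarith)
          exact ufield_one lam n (retr_mem d _) hd (this.trans rfl)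
      · have hk' : k < d := by omega
        refine stays_nonpos (fun t => extd d (α t) (k+1+1) - extd d (α t) (k+1))
          (fun t => ufield lam n d (retr d (α t)) (k+2) - ufield lam n d (retr d (α t)) (k+1))
          hi ?_ ?_
        · intro t ht
          simp only [extd, dif_pos hk, dif_pos hk']
          exact (hαi ⟨k+1, hk⟩ t ht).sub (hαi ⟨k, hk'⟩ t ht)
        · intro t ht h
          have := retr_face d (α t) (k+1) hk (by linarith)
          have := ufield_tangent lam hlam0 n (retr_mem d (α t)) k (by omega) this
          linarith
    · subst hk
      obtain ⟨e, rfl⟩ : ∃ e, k = e + 1 := ⟨k - 1, by omega⟩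
      refine stays_nonpos (fun t => extd (e+1) (α t) (e+1+1) - extd (e+1) (α t) (e+1))
        (fun t => - ufield lam n (e+1) (retr (e+1) (α t)) (e+1)) hi ?_ ?_
      · intro t ht
        simp only [extd, dif_pos (Nat.lt_succ_self e), lt_irrefl, dite_false, zero_sub]
        exact (hαi ⟨e, Nat.lt_succ_self e⟩ t ht).neg
      · intro t ht h
        simp only [extd, dif_pos (Nat.lt_succ_self e), lt_irrefl, dite_false, zero_sub] at h
        have : retr (e+1) (α t) (e+1) = 0 := by
          rw [retr, dif_pos (Nat.lt_succ_self e), max_eq_left (by linarith)]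
          exact min_eq_right ((retr_mem _ _).2.2.1 e).1
        have := ufield_zero lam hlam0 n hn (retr_mem (e+1) (α t)) hd this
        linarith
    · intro t ht
      obtain ⟨e, rfl⟩ : ∃ e, k = e + 1 := ⟨k - 1, by omega⟩
      simp only [extd]
      rw [dif_neg (by omega), dif_neg (by omega)]; simp
  have hmem : ∀ t, 0 ≤ t → memDd d (extd d (α t)) := by
    intro t ht
    have hanti : Antitone (extd d (α t)) := antitone_nat_of_succ_le fun k => hmono k t ht
    have hz : ∀ k, d < k → extd d (α t) k = 0 := by
      intro k hk
      obtain ⟨e, rfl⟩ : ∃ e, k = e + 1 := ⟨k - 1, by omega⟩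
      rw [extd, dif_neg (by omega)]
    refine ⟨rfl, fun k => hmono k t ht, fun k => ⟨?_, hanti (Nat.zero_le k)⟩, hz⟩
    rw [← hz (k + d + 1) (by omega)]
    exact hanti (by omega)
  have hretr : ∀ t, 0 ≤ t → retr d (α t) = extd d (α t) := by
    intro t ht
    have := retr_eq d _ (hmem t ht)
    rw [← this]
    congr 1
    funext i
    simp [this, extd]
  refine ⟨fun k t => extd d (α t) k, ⟨⟨hmem, ?_⟩, hstart⟩, ?_⟩
  · intro k hk t ht
    obtain ⟨e, rfl⟩ : ∃ e, k = e + 1 := ⟨k - 1, by omega⟩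
    by_cases he : e < d
    · have := hαi ⟨e, he⟩ t ht
      rw [hretr t ht] at this
      simp only [extd, dif_pos he]
      exact this
    · have : ufield lam n d (fun j => extd d (α t) j) (e+1) = 0 := by
        unfold ufield; rw [if_neg (by omega), if_neg (by omega)]
      rw [this]
      simp only [extd, dif_neg he]
      exact hasDerivWithinAt_const _ _ _
  · intro y hy hy0 k hk1 hkd t ht
    let Y : ℝ → Fin d → ℝ := fun s i => y (i+1) s
    have hY : ∀ s, 0 ≤ s → HasDerivWithinAt Y (Ffield lam n d (Y s)) (Set.Ici 0) s := by
      intro s hs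
      rw [hasDerivWithinAt_pi]
      intro i
      have := hy.2 (i+1) (by omega) s hs
      have e : retr d (Y s) = fun j => y j s := retr_eq d _ (hy.1 s hs)
      unfold Ffield
      rw [e]
      exact this
    have hu := ODE_solution_unique_of_mem_Icc_right (v := fun _ => Ffield lam n d)
      (s := fun _ => Set.univ) (f := Y) (g := α) (a := 0) (b := t)
      (fun _ _ => (Ffield_lip lam hlam0 hlam1 n d).lipschitzOnWith)
      (fun s hs => (hY s hs.1).continuousWithinAt.mono Set.Icc_subset_Ici_self)
      (fun s hs => (hY s hs.1).mono (Set.Ici_subset_Ici.2 hs.1)) (fun _ _ => trivial)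
      (fun s hs => (hα s hs.1).continuousWithinAt.mono Set.Icc_subset_Ici_self)
      (fun s hs => (hα s hs.1).mono (Set.Ici_subset_Ici.2 hs.1)) (fun _ _ => trivial)
      (by rw [hα0]; funext i; exact hy0 _)
    have := congrFun (hu ⟨ht, le_rfl⟩) ⟨k-1, by omega⟩
    obtain ⟨e, rfl⟩ : ∃ e, k = e + 1 := ⟨k - 1, by omega⟩
    simp only [extd]
    rw [dif_pos (show e < d by omega)]
    exact this

end
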